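/- Proximal decrease bound under the growth condition: Let f : ℝ^d → ℝ be convex, let λ > 0, p ∈ ℝ^d and L > 0, and assume f(u) − f(v) ≤ L(1 + ‖u − p‖)‖u − v‖ for all u, v ∈ ℝ^d. If x ∈ ℝ^d and z is a minimizer of y ↦ f(y) + (1/(2λ))‖x − y‖², then f(x) − f(z) ≤ 2λ L² (1 + ‖x − p‖)² ≤ 4λ L² (1 + ‖x − p‖²). -/

import Mathlib

/-- Proximal decrease bound under the growth condition:
if `f u - f v ≤ L (1 + ‖u - p‖) ‖u - v‖` for all `u, v` and `z` minimizes
`y ↦ f y + (1/(2λ)) ‖x - y‖²`, then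
`f x - f z ≤ 2 λ L² (1 + ‖x - p‖)² ≤ 4 λ L² (1 + ‖x - p‖²)`. -/
theorem prox_decrease_bound {d : ℕ}
    (f : EuclideanSpace ℝ (Fin d) → ℝ) (hconv : ConvexOn ℝ Set.univ f)
    (lam : ℝ) (hlam : 0 < lam) (p : EuclideanSpace ℝ (Fin d)) (L : ℝ) (hL : 0 < L)
    (hgrowth : ∀ u v : EuclideanSpace ℝ (Fin d),
      f u - f v ≤ L * (1 + ‖u - p‖) * ‖u - v‖)
    (x z : EuclideanSpace ℝ (Fin d))
    (hz : ∀ y : EuclideanSpace ℝ (Fin d),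
      f z + (1 / (2 * lam)) * ‖x - z‖ ^ 2 ≤ f y + (1 / (2 * lam)) * ‖x - y‖ ^ 2) :
    f x - f z ≤ 2 * lam * L ^ 2 * (1 + ‖x - p‖) ^ 2 ∧
      2 * lam * L ^ 2 * (1 + ‖x - p‖) ^ 2 ≤ 4 * lam * L ^ 2 * (1 + ‖x - p‖ ^ 2) := by
  have hA : 0 < L * (1 + ‖x - p‖) := by positivity
  have hupper := hgrowth x z
  have hlower : ‖x - z‖ ^ 2 ≤ 2 * lam * (f x - f z) := by
    have h := hz x
    rw [sub_self, norm_zero] at h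
    have h' : ‖x - z‖ ^ 2 / (2 * lam) ≤ f x - f z := by
      rw [div_eq_inv_mul, ← one_div]
      linarith
    rwa [div_le_iff₀' (by positivity)] at h'
  have hdist : ‖x - z‖ ≤ 2 * lam * (L * (1 + ‖x - p‖)) := by
    by_contra! hlt
    have hpos : 0 < ‖x - z‖ := lt_trans (by positivity) hlt
    have h₁ := mul_lt_mul_of_pos_right hlt hpos
    have h₂ := mul_le_mul_of_nonneg_left hupper (by positivity : 0 ≤ 2 * lam)
    linarith
  constructor
  · calc f x - f z ≤ L * (1 + ‖x - p‖) * ‖x - z‖ := hupper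
      _ ≤ L * (1 + ‖x - p‖) * (2 * lam * (L * (1 + ‖x - p‖))) := by gcongr
      _ = 2 * lam * L ^ 2 * (1 + ‖x - p‖) ^ 2 := by ring
  · have h : 0 ≤ 2 * lam * L ^ 2 * (1 - ‖x - p‖) ^ 2 := by positivity
    linarith
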